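/- Let P = ⟨A | R⟩ and P' = ⟨A' | R'⟩ be finite presentations of groups Γ and Γ'. Suppose there exist a map f : Γ → Γ' and constants λ ≥ 1, C ≥ 0 such that for all x, y ∈ Γ, λ⁻¹·d_A(x,y) − C ≤ d_{A'}(f(x), f(y)) ≤ λ·d_A(x,y) + C, and every element of Γ' lies within d_{A'}-distance C of the image of f (i.e. f is a quasi-isometry). Then there exists K > 0 such that for all n: FL_{P'}(n) ≤ K·FL_P(Kn+K) + Kn + K and FL_P(n) ≤ K·FL_{P'}(Kn+K) + Kn + K, and the analogous pairs of inequalities hold with FL replaced by FFL and by FFFL. In particular FL, FFL and FFFL are, up to ≃-equivalence, quasi-isometry invariants of finitely presented groups. -/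

import Mathlib

/-! Words over an alphabet `A`: a letter `(x, true)` is the generator `x`,
and `(x, false)` is its formal inverse `x⁻¹`. -/

/-- A word over the alphabet `A ∪ A⁻¹`. -/
abbrev Word (A : Type*) := List (A × Bool)

namespace Word

/-- The formal inverse of a word. -/
def inv {A : Type*} (w : Word A) : Word A := (w.map fun p => (p.1, !p.2)).reverse

/-- `w'` is a cyclic conjugate (cyclic permutation) of `w`. -/
def IsCyclicConj {A : Type*} (w w' : Word A) : Prop :=
  ∃ u v : Word A, w = u ++ v ∧ w' = v ++ u

end Word

/-- Moves (i)–(iii) on words with respect to a set `R` of relator words: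
free reduction, free expansion, and application of a relator (replace a subword `u`
by `v` where some cyclic conjugate of `u * v⁻¹` lies in `R ∪ R⁻¹`). -/
inductive Move {A : Type*} (R : Set (Word A)) : Word A → Word A → Prop
  | freeReduce (u v : Word A) (x : A) (b : Bool) :
      Move R (u ++ (x, b) :: (x, !b) :: v) (u ++ v)
  | freeExpand (u v : Word A) (x : A) (b : Bool) :
      Move R (u ++ v) (u ++ (x, b) :: (x, !b) :: v)
  | relator (p q u v z : Word A)
      (hz : Word.IsCyclicConj (u ++ Word.inv v) z) (hR : z ∈ R ∨ Word.inv z ∈ R) :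
      Move R (p ++ u ++ q) (p ++ v ++ q)

/-- Moves (i)–(iv): moves (i)–(iii) together with cyclic conjugation. -/
inductive MoveC {A : Type*} (R : Set (Word A)) : Word A → Word A → Prop
  | of {w w' : Word A} : Move R w w' → MoveC R w w'
  | cyc {w w' : Word A} : Word.IsCyclicConj w w' → MoveC R w w'

/-- Moves (i)–(v) on finite sequences of words: one of the moves (i)–(iv) applied to
one word of the sequence, or fragmentation of one word `u ++ v` into `u` and `v`. -/
inductive MoveF {A : Type*} (R : Set (Word A)) : List (Word A) → List (Word A) → Prop
  | of (l₁ l₂ : List (Word A)) {w w' : Word A} :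
      MoveC R w w' → MoveF R (l₁ ++ w :: l₂) (l₁ ++ w' :: l₂)
  | frag (l₁ l₂ : List (Word A)) (u v : Word A) :
      MoveF R (l₁ ++ (u ++ v) :: l₂) (l₁ ++ u :: v :: l₂)

/-- A word is null-homotopic over the presentation with relator set `R` if it represents
the identity of the presented group, i.e. lies in the normal closure of the relators. -/
def NullHomotopic {A : Type*} (R : Set (Word A)) (w : Word A) : Prop :=
  FreeGroup.mk w ∈ Subgroup.normalClosure (FreeGroup.mk '' R)

/-- `FLle R w L`: the word `w` can be converted to the empty word by moves (i)–(iii)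
with every intermediate word of length at most `L`. -/
def FLle {A : Type*} (R : Set (Word A)) (w : Word A) (L : ℕ) : Prop :=
  ∃ (m : ℕ) (f : ℕ → Word A), f 0 = w ∧ f m = [] ∧
    (∀ i < m, Move R (f i) (f (i + 1))) ∧ ∀ i ≤ m, (f i).length ≤ L

/-- `FFLle R w L`: the word `w` can be converted to the empty word by moves (i)–(iv)
with every intermediate word of length at most `L`. -/
def FFLle {A : Type*} (R : Set (Word A)) (w : Word A) (L : ℕ) : Prop :=
  ∃ (m : ℕ) (f : ℕ → Word A), f 0 = w ∧ f m = [] ∧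
    (∀ i < m, MoveC R (f i) (f (i + 1))) ∧ ∀ i ≤ m, (f i).length ≤ L

/-- The total length of a finite sequence of words. -/
def totalLength {A : Type*} (l : List (Word A)) : ℕ := (l.map List.length).sum

/-- `FFFLle R w L`: the length-one sequence `(w)` can be converted to a sequence of empty
words by moves (i)–(v) with every intermediate sequence of total length at most `L`. -/
def FFFLle {A : Type*} (R : Set (Word A)) (w : Word A) (L : ℕ) : Prop :=
  ∃ (m : ℕ) (f : ℕ → List (Word A)), f 0 = [w] ∧ (∀ u ∈ f m, u = ([] : Word A)) ∧
    (∀ i < m, MoveF R (f i) (f (i + 1))) ∧ ∀ i ≤ m, totalLength (f i) ≤ L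

/-- An element `x` of the free group is a conjugate of a relator of `R` or of an inverse
of a relator. -/
def IsConjRelator {A : Type*} (R : Set (Word A)) (x : FreeGroup A) : Prop :=
  ∃ c ρ : FreeGroup A, (ρ ∈ FreeGroup.mk '' R ∨ ρ⁻¹ ∈ FreeGroup.mk '' R) ∧ x = c * ρ * c⁻¹

/-- `AreaLe R g N`: in the free group, `g` is a product of at most `N` conjugates
of elements of `R ∪ R⁻¹`. -/
def AreaLe {A : Type*} (R : Set (Word A)) (g : FreeGroup A) (N : ℕ) : Prop :=
  ∃ l : List (FreeGroup A), l.length ≤ N ∧ (∀ x ∈ l, IsConjRelator R x) ∧ l.prod = g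

/-- The number of occurrences in `w` of the letter `x` or its inverse. -/
def countLtr {A : Type*} [DecidableEq A] (x : A) (w : Word A) : ℕ :=
  (w.filter fun p => p.1 = x).length

/-- The filling length `FL(w)` of a null-homotopic word. -/
noncomputable def FLw {A : Type*} (R : Set (Word A)) (w : Word A) : ℕ :=
  sInf {L | FLle R w L}

/-- The free filling length `FFL(w)` of a null-homotopic word. -/
noncomputable def FFLw {A : Type*} (R : Set (Word A)) (w : Word A) : ℕ :=
  sInf {L | FFLle R w L}

/-- The fragmenting free filling length `FFFL(w)` of a null-homotopic word. -/
noncomputable def FFFLw {A : Type*} (R : Set (Word A)) (w : Word A) : ℕ :=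
  sInf {L | FFFLle R w L}

/-- The filling length function `FL : ℕ → ℕ` of the presentation with relators `R`. -/
noncomputable def FLfn {A : Type*} (R : Set (Word A)) (n : ℕ) : ℕ :=
  sSup (FLw R '' {w | NullHomotopic R w ∧ w.length ≤ n})

/-- The free filling length function `FFL : ℕ → ℕ`. -/
noncomputable def FFLfn {A : Type*} (R : Set (Word A)) (n : ℕ) : ℕ :=
  sSup (FFLw R '' {w | NullHomotopic R w ∧ w.length ≤ n})

/-- The fragmenting free filling length function `FFFL : ℕ → ℕ`. -/
noncomputable def FFFLfn {A : Type*} (R : Set (Word A)) (n : ℕ) : ℕ :=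
  sSup (FFFLw R '' {w | NullHomotopic R w ∧ w.length ≤ n})

/-! The presentation `Q = ⟨a, b, r, s, t | a^b a⁻², [t,a], [r,at], [r,s], [s,t]⟩`. -/

/-- The five generators of the presentation `Q`. -/
inductive QGen | a | b | r | s | t
deriving DecidableEq

/-- The five relators of `Q`: `b⁻¹aba⁻¹a⁻¹`, `t⁻¹a⁻¹ta`, `r⁻¹t⁻¹a⁻¹rat`,
`r⁻¹s⁻¹rs`, `s⁻¹t⁻¹st`. -/
def QRels : Set (Word QGen) :=
  { [(QGen.b, false), (QGen.a, true), (QGen.b, true), (QGen.a, false), (QGen.a, false)],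
    [(QGen.t, false), (QGen.a, false), (QGen.t, true), (QGen.a, true)],
    [(QGen.r, false), (QGen.t, false), (QGen.a, false), (QGen.r, true), (QGen.a, true),
      (QGen.t, true)],
    [(QGen.r, false), (QGen.s, false), (QGen.r, true), (QGen.s, true)],
    [(QGen.s, false), (QGen.t, false), (QGen.s, true), (QGen.t, true)] }

/-- The word `bⁿ`. -/
def bpow (n : ℕ) : Word QGen := List.replicate n (QGen.b, true)

/-- The word `b⁻ⁿ`. -/
def bpowInv (n : ℕ) : Word QGen := List.replicate n (QGen.b, false)

/-- The word `a^{-bⁿ} = b⁻ⁿ a⁻¹ bⁿ`. -/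
def aConjNeg (n : ℕ) : Word QGen := bpowInv n ++ [(QGen.a, false)] ++ bpow n

/-- The word `a^{bⁿ} = b⁻ⁿ a bⁿ`. -/
def aConjPos (n : ℕ) : Word QGen := bpowInv n ++ [(QGen.a, true)] ++ bpow n

/-- The word `a^{-bⁿ} r a^{bⁿ}`. -/
def gword (n : ℕ) : Word QGen := aConjNeg n ++ [(QGen.r, true)] ++ aConjPos n

/-- The word `w_n = [s, a^{-bⁿ} r a^{bⁿ}] = s⁻¹ (b⁻ⁿa⁻¹bⁿ r b⁻ⁿabⁿ)⁻¹ s (b⁻ⁿa⁻¹bⁿ r b⁻ⁿabⁿ)`. -/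
def wn (n : ℕ) : Word QGen :=
  [(QGen.s, false)] ++ Word.inv (gword n) ++ [(QGen.s, true)] ++ gword n

/-- The word `a^{-bⁿ} r a^{bⁿ} r a^{bⁿ} r⁻¹ a^{-bⁿ}`. -/
def g'word (n : ℕ) : Word QGen :=
  aConjNeg n ++ [(QGen.r, true)] ++ aConjPos n ++ [(QGen.r, true)] ++ aConjPos n ++
    [(QGen.r, false)] ++ aConjNeg n

/-- The word `w'_n = [s, a^{-bⁿ} r a^{bⁿ} r a^{bⁿ} r⁻¹ a^{-bⁿ}]`. -/
def w'n (n : ℕ) : Word QGen :=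
  [(QGen.s, false)] ++ Word.inv (g'word n) ++ [(QGen.s, true)] ++ g'word n

/-- The group presented by the presentation with relator words `R`. -/
abbrev PGroup {A : Type*} (R : Set (Word A)) := PresentedGroup (FreeGroup.mk '' R)

/-- The word metric on the presented group: the least length of a word
representing `x⁻¹ * y`. -/
noncomputable def wdist {A : Type*} (R : Set (Word A)) (x y : PGroup R) : ℕ :=
  sInf {n | ∃ w : Word A, w.length = n ∧
    PresentedGroup.mk (FreeGroup.mk '' R) (FreeGroup.mk w) = x⁻¹ * y}

/-! ### Evaluation of words and the word metric -/

/-- The element of the presented group represented by a word. -/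
def wval {A : Type*} (R : Set (Word A)) (w : Word A) : PGroup R :=
  PresentedGroup.mk (FreeGroup.mk '' R) (FreeGroup.mk w)

section Words

variable {A : Type*} {R : Set (Word A)}

@[simp] lemma wval_nil : wval R [] = 1 := map_one _

@[simp] lemma wval_append (u v : Word A) : wval R (u ++ v) = wval R u * wval R v := by
  simp only [wval, ← FreeGroup.mul_mk, map_mul]

lemma wval_cons (p : A × Bool) (v : Word A) : wval R (p :: v) = wval R [p] * wval R v :=
  wval_append [p] v

@[simp] lemma wval_inv (w : Word A) : wval R (Word.inv w) = (wval R w)⁻¹ := by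
  simp only [wval, ← map_inv, FreeGroup.inv_mk]
  rfl

@[simp] lemma Word.length_inv (w : Word A) : (Word.inv w).length = w.length := by
  simp [Word.inv]

lemma nullHomotopic_iff {w : Word A} : NullHomotopic R w ↔ wval R w = 1 :=
  PresentedGroup.mk_eq_one_iff.symm

lemma wval_surjective : Function.Surjective (wval R) := fun g => by
  obtain ⟨x, rfl⟩ := PresentedGroup.mk_surjective _ g
  obtain ⟨w, rfl⟩ := Quot.exists_rep x
  exact ⟨w, rfl⟩

lemma wdist_le {x y : PGroup R} {w : Word A} (h : wval R w = x⁻¹ * y) :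
    wdist R x y ≤ w.length :=
  Nat.sInf_le ⟨w, rfl, h⟩

lemma exists_word_length_eq_wdist (x y : PGroup R) :
    ∃ w : Word A, w.length = wdist R x y ∧ wval R w = x⁻¹ * y := by
  obtain ⟨w, hw⟩ := wval_surjective (x⁻¹ * y)
  exact Nat.sInf_mem (s := {n | ∃ w : Word A, w.length = n ∧ wval R w = x⁻¹ * y})
    ⟨_, w, rfl, hw⟩

lemma wdist_symm (x y : PGroup R) : wdist R x y = wdist R y x := by
  have key : ∀ x y : PGroup R, wdist R x y ≤ wdist R y x := fun x y => by
    obtain ⟨w, hw, h⟩ := exists_word_length_eq_wdist y x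
    rw [← hw, ← Word.length_inv]
    exact wdist_le (by simp [h])
  exact le_antisymm (key x y) (key y x)

lemma wdist_triangle (x y z : PGroup R) : wdist R x z ≤ wdist R x y + wdist R y z := by
  obtain ⟨u, hu, h⟩ := exists_word_length_eq_wdist x y
  obtain ⟨v, hv, h'⟩ := exists_word_length_eq_wdist y z
  rw [← hu, ← hv, ← List.length_append]
  exact wdist_le (by simp [h, h', mul_assoc])

lemma wdist_mul_letter (x : PGroup R) (p : A × Bool) : wdist R x (x * wval R [p]) ≤ 1 :=
  wdist_le (w := [p]) (by simp)

/-! ### Moves and equality in the presented group -/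

lemma wval_letter_mul (x : A) (b : Bool) : wval R [(x, b)] * wval R [(x, !b)] = 1 := by
  have : [(x, !b)] = Word.inv [(x, b)] := rfl
  rw [this, wval_inv, mul_inv_cancel]

lemma wval_eq_one_of_mem {z : Word A} (h : z ∈ R ∨ Word.inv z ∈ R) : wval R z = 1 := by
  have key : ∀ z ∈ R, wval R z = 1 := fun z hz =>
    PresentedGroup.one_of_mem (Set.mem_image_of_mem _ hz)
  rcases h with h | h
  · exact key z h
  · simpa using key _ h

lemma Word.IsCyclicConj.wval_eq_one_iff {u v : Word A} (h : Word.IsCyclicConj u v) :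
    wval R u = 1 ↔ wval R v = 1 := by
  obtain ⟨a, b, rfl, rfl⟩ := h
  simp only [wval_append]
  rw [mul_eq_one_iff_eq_inv, mul_eq_one_iff_inv_eq, eq_comm]

/-- A move replaces a subword of bounded length by another one of the same value. -/
lemma Move.exists_local {N : ℕ} (hN : 2 ≤ N) (hR : ∀ z ∈ R, z.length ≤ N) {w w' : Word A}
    (h : Move R w w') : ∃ p u v q : Word A, w = p ++ u ++ q ∧ w' = p ++ v ++ q ∧
      u.length ≤ N ∧ v.length ≤ N ∧ wval R u = wval R v := by
  cases h with
  | freeReduce u v x b =>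
    refine ⟨u, [(x, b), (x, !b)], [], v, by simp, by simp, by simpa, by simp, ?_⟩
    rw [wval_cons, wval_letter_mul, wval_nil]
  | freeExpand u v x b =>
    refine ⟨u, [], [(x, b), (x, !b)], v, by simp, by simp, by simp, by simpa, ?_⟩
    rw [wval_cons, wval_letter_mul, wval_nil]
  | relator p q u v z hz hzR =>
    have hlen : z.length ≤ N := by
      rcases hzR with h | h
      · exact hR z h
      · simpa using hR _ h
    have h1 := hz.wval_eq_one_iff.2 (wval_eq_one_of_mem hzR)
    have h2 : u.length + v.length = z.length := by
      obtain ⟨a, b, hab, rfl⟩ := hz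
      have := congrArg List.length hab
      simp only [List.length_append, Word.length_inv] at this ⊢
      omega
    refine ⟨p, u, v, q, rfl, rfl, by omega, by omega, ?_⟩
    rwa [wval_append, wval_inv, mul_inv_eq_one] at h1

lemma Move.wval_eq {w w' : Word A} (h : Move R w w') : wval R w = wval R w' := by
  cases h with
  | freeReduce u v x b =>
    rw [wval_append, wval_cons, wval_cons _ v, ← mul_assoc (wval R [(x, b)]), wval_letter_mul,
      one_mul, wval_append]
  | freeExpand u v x b =>
    rw [wval_append, wval_append, wval_cons, wval_cons _ v, ← mul_assoc (wval R [(x, b)]),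
      wval_letter_mul, one_mul]
  | relator p q u v z hz hzR =>
    have h1 := hz.wval_eq_one_iff.2 (wval_eq_one_of_mem hzR)
    rw [wval_append, wval_inv, mul_inv_eq_one] at h1
    simp [h1]

lemma MoveC.wval_eq_one_iff {w w' : Word A} (h : MoveC R w w') :
    wval R w = 1 ↔ wval R w' = 1 := by
  cases h with
  | of h => rw [h.wval_eq]
  | cyc h => exact h.wval_eq_one_iff

lemma Move.append_context (p q : Word A) {u v : Word A} (h : Move R u v) :
    Move R (p ++ u ++ q) (p ++ v ++ q) := by
  cases h with
  | freeReduce u v x b => simpa using Move.freeReduce (R := R) (p ++ u) (v ++ q) x b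
  | freeExpand u v x b => simpa using Move.freeExpand (R := R) (p ++ u) (v ++ q) x b
  | relator p' q' u v z hz hzR =>
    simpa using Move.relator (R := R) (p ++ p') (q' ++ q) u v z hz hzR

lemma Word.inv_append (u v : Word A) : Word.inv (u ++ v) = Word.inv v ++ Word.inv u := by
  simp [Word.inv]

lemma Word.inv_inv (u : Word A) : Word.inv (Word.inv u) = u := FreeGroup.invRev_invRev

lemma Move.symm {u v : Word A} (h : Move R u v) : Move R v u := by
  cases h with
  | freeReduce u v x b => exact .freeExpand u v x b
  | freeExpand u v x b => exact .freeReduce u v x b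
  | relator p q u v z hz hzR =>
    refine .relator p q v u (Word.inv z) ?_ (by rw [Word.inv_inv]; exact hzR.symm)
    obtain ⟨a, b, hab, rfl⟩ := hz
    refine ⟨Word.inv b, Word.inv a, ?_, Word.inv_append _ _⟩
    rw [← Word.inv_append, ← hab, Word.inv_append, Word.inv_inv]

open Relation

lemma reflTransGen_move_symm {u v : Word A} (h : ReflTransGen (Move R) u v) :
    ReflTransGen (Move R) v u :=
  haveI : Std.Symm (Move R) := ⟨fun _ _ => Move.symm⟩
  Std.Symm.symm _ _ h

lemma reflTransGen_move_context (p q : Word A) {u v : Word A} (h : ReflTransGen (Move R) u v) :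
    ReflTransGen (Move R) (p ++ u ++ q) (p ++ v ++ q) :=
  h.lift (fun w => p ++ w ++ q) fun _ _ => Move.append_context p q

lemma reflTransGen_move_append {u v u' v' : Word A} (h : ReflTransGen (Move R) u v)
    (h' : ReflTransGen (Move R) u' v') : ReflTransGen (Move R) (u ++ u') (v ++ v') := by
  have h1 := reflTransGen_move_context [] u' h
  have h2 := reflTransGen_move_context v [] h'
  simp only [List.nil_append, List.append_nil] at h1 h2
  exact h1.trans h2

lemma reflTransGen_move_of_mk_eq {u v : Word A} (h : FreeGroup.mk u = FreeGroup.mk v) :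
    ReflTransGen (Move R) u v := by
  have step : ∀ {u v : Word A}, FreeGroup.Red u v → ReflTransGen (Move R) u v := fun h => by
    refine ReflTransGen.mono ?_ _ _ h
    rintro _ _ ⟨⟩
    exact .freeReduce _ _ _ _
  obtain ⟨w, hu, hv⟩ := FreeGroup.Red.exact.1 h
  exact (step hu).trans (reflTransGen_move_symm (step hv))

lemma reflTransGen_move_of_wval_eq_one {w : Word A} (h : wval R w = 1) :
    ReflTransGen (Move R) w [] := by
  let N : Subgroup (FreeGroup A) :=
    { carrier := {g | ∀ w, FreeGroup.mk w = g → ReflTransGen (Move R) w []}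
      one_mem' := fun w hw => reflTransGen_move_of_mk_eq hw
      mul_mem' := by
        intro a b ha hb w hw
        obtain ⟨u, rfl⟩ := Quot.exists_rep a
        obtain ⟨v, rfl⟩ := Quot.exists_rep b
        exact (reflTransGen_move_of_mk_eq hw).trans
          (reflTransGen_move_append (ha u rfl) (hb v rfl))
      inv_mem' := by
        intro a ha w hw
        have h1 := ha (Word.inv w)
          (by rw [show Word.inv w = FreeGroup.invRev w from rfl, ← FreeGroup.inv_mk, hw, inv_inv])
        have h2 : ReflTransGen (Move R) [] (w ++ Word.inv w) :=
          reflTransGen_move_of_mk_eq (by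
            rw [show Word.inv w = FreeGroup.invRev w from rfl, ← FreeGroup.mul_mk,
              ← FreeGroup.inv_mk, mul_inv_cancel, FreeGroup.one_eq_mk])
        have h3 := reflTransGen_move_append (ReflTransGen.refl (a := w)) h1
        rw [List.append_nil] at h3
        exact reflTransGen_move_symm (h2.trans h3) }
  have hN : N.Normal := by
    refine ⟨fun a ha g w hw => ?_⟩
    obtain ⟨u, rfl⟩ := Quot.exists_rep a
    obtain ⟨v, rfl⟩ := Quot.exists_rep g
    refine (reflTransGen_move_of_mk_eq (v := v ++ u ++ Word.inv v) ?_).trans ?_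
    · rw [hw, show Word.inv v = FreeGroup.invRev v from rfl, ← FreeGroup.mul_mk,
        ← FreeGroup.mul_mk, ← FreeGroup.inv_mk]
      rfl
    · refine (reflTransGen_move_context v (Word.inv v) (ha u rfl)).trans
        (reflTransGen_move_of_mk_eq ?_)
      rw [List.append_nil, show Word.inv v = FreeGroup.invRev v from rfl, ← FreeGroup.mul_mk,
        ← FreeGroup.inv_mk, mul_inv_cancel, FreeGroup.one_eq_mk]
  have hle : Subgroup.normalClosure (FreeGroup.mk '' R) ≤ N := by
    refine Subgroup.normalClosure_le_normal ?_
    rintro _ ⟨z, hz, rfl⟩ w hw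
    refine (reflTransGen_move_of_mk_eq hw).trans (.single ?_)
    simpa using Move.relator (R := R) [] [] z [] z
      ⟨z, [], by simp [Word.inv], by simp⟩ (Or.inl hz)
  exact hle (nullHomotopic_iff.2 h) w rfl

lemma reflTransGen_move_of_wval_eq {u v : Word A} (h : wval R u = wval R v) :
    ReflTransGen (Move R) u v := by
  have h1 : ReflTransGen (Move R) (u ++ Word.inv v) [] :=
    reflTransGen_move_of_wval_eq_one (by simp [h])
  have h2 : ReflTransGen (Move R) (Word.inv v ++ v) [] :=
    reflTransGen_move_of_wval_eq_one (by simp)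
  have h3 := reflTransGen_move_append (ReflTransGen.refl (a := u)) h2
  have h4 := reflTransGen_move_append h1 (ReflTransGen.refl (a := v))
  simp only [List.append_nil, List.nil_append, ← List.append_assoc] at h3 h4
  exact (reflTransGen_move_symm h3).trans h4

end Words

/-! ### Conversions through objects of bounded size -/

/-- `y` is reachable from `x` by steps of `r` between objects of size at most `L`. -/
def BReach {α : Type*} (r : α → α → Prop) (size : α → ℕ) (L : ℕ) : α → α → Prop :=
  Relation.ReflTransGen fun x y => r x y ∧ size x ≤ L ∧ size y ≤ L

namespace BReach

variable {α β : Type*} {r : α → α → Prop} {size : α → ℕ} {L L' : ℕ} {x y z : α}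

lemma refl (x : α) : BReach r size L x x := Relation.ReflTransGen.refl

lemma trans (h : BReach r size L x y) (h' : BReach r size L y z) : BReach r size L x z :=
  Relation.ReflTransGen.trans h h'

lemma single (h : r x y) (hx : size x ≤ L) (hy : size y ≤ L) : BReach r size L x y :=
  Relation.ReflTransGen.single ⟨h, hx, hy⟩

lemma map {s : β → β → Prop} {size' : β → ℕ} (f : α → β) (hf : ∀ a b, r a b → s (f a) (f b))
    (hs : ∀ a, size a ≤ L → size' (f a) ≤ L') (h : BReach r size L x y) :
    BReach s size' L' (f x) (f y) :=
  Relation.ReflTransGen.lift f (fun _ _ h => ⟨hf _ _ h.1, hs _ h.2.1, hs _ h.2.2⟩) _ _ h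

lemma mono (hL : L ≤ L') (h : BReach r size L x y) : BReach r size L' x y :=
  h.map id (fun _ _ => id) fun _ h => h.trans hL

lemma exists_of_reflTransGen (h : Relation.ReflTransGen r x y) : ∃ L, BReach r size L x y := by
  induction h with
  | refl => exact ⟨0, refl _⟩
  | @tail b c _ h ih =>
    obtain ⟨L, hL⟩ := ih
    refine ⟨max L (max (size b) (size c)), (hL.mono (by simp)).trans (single h ?_ ?_)⟩ <;> simp

lemma exists_seq_iff (P : α → Prop) :
    (∃ (m : ℕ) (f : ℕ → α), f 0 = x ∧ P (f m) ∧ (∀ i < m, r (f i) (f (i + 1))) ∧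
      ∀ i ≤ m, size (f i) ≤ L) ↔ size x ≤ L ∧ ∃ y, P y ∧ BReach r size L x y := by
  constructor
  · rintro ⟨m, f, rfl, hP, hr, hs⟩
    refine ⟨hs 0 (Nat.zero_le _), f m, hP, ?_⟩
    have key : ∀ k ≤ m, BReach r size L (f 0) (f k) := by
      intro k
      induction k with
      | zero => exact fun _ => refl _
      | succ k ih =>
        exact fun hk => (ih (by omega)).trans
          (single (hr k hk) (hs k (by omega)) (hs (k + 1) hk))
    exact key m le_rfl
  · rintro ⟨hx, y, hP, h⟩
    induction h using Relation.ReflTransGen.head_induction_on with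
    | refl => exact ⟨0, fun _ => y, rfl, hP, by simp, fun _ _ => hx⟩
    | @head a c h' _ ih =>
      obtain ⟨m, f, rfl, hPf, hr, hs⟩ := ih h'.2.2
      refine ⟨m + 1, fun i => Nat.casesOn i a f, rfl, hPf, fun i hi => ?_, fun i hi => ?_⟩
      · cases i with
        | zero => exact h'.1
        | succ i => exact hr i (by omega)
      · cases i with
        | zero => exact hx
        | succ i => exact hs i (by omega)

end BReach

section Conversions

variable {A : Type*} {R : Set (Word A)}

/-- Conversion of words by moves (i)–(iii) through words of length at most `L`. -/
abbrev Conv (R : Set (Word A)) (L : ℕ) : Word A → Word A → Prop :=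
  BReach (Move R) List.length L

/-- Conversion of words by moves (i)–(iv) through words of length at most `L`. -/
abbrev ConvC (R : Set (Word A)) (L : ℕ) : Word A → Word A → Prop :=
  BReach (MoveC R) List.length L

/-- Conversion of sequences by moves (i)–(v) through sequences of total length at most `L`. -/
abbrev ConvF (R : Set (Word A)) (L : ℕ) : List (Word A) → List (Word A) → Prop :=
  BReach (MoveF R) totalLength L

@[simp] lemma totalLength_append (l₁ l₂ : List (Word A)) :
    totalLength (l₁ ++ l₂) = totalLength l₁ + totalLength l₂ := by
  simp [totalLength]

@[simp] lemma totalLength_cons (w : Word A) (l : List (Word A)) :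
    totalLength (w :: l) = w.length + totalLength l := by
  simp [totalLength]

@[simp] lemma totalLength_nil : totalLength ([] : List (Word A)) = 0 := rfl

lemma Conv.context {L L' : ℕ} {u v : Word A} (h : Conv R L u v) (p q : Word A)
    (hL : p.length + L + q.length ≤ L') : Conv R L' (p ++ u ++ q) (p ++ v ++ q) :=
  h.map (fun w => p ++ w ++ q) (fun _ _ => Move.append_context p q) fun a ha => by
    simp only [List.length_append]
    omega

lemma Conv.toConvC {L : ℕ} {u v : Word A} (h : Conv R L u v) : ConvC R L u v :=
  h.map id (fun _ _ => .of) fun _ => id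

lemma ConvC.toConvF {L L' : ℕ} {u v : Word A} (h : ConvC R L u v) (l₁ l₂ : List (Word A))
    (hL : totalLength l₁ + L + totalLength l₂ ≤ L') :
    ConvF R L' (l₁ ++ u :: l₂) (l₁ ++ v :: l₂) :=
  h.map (fun w => l₁ ++ w :: l₂) (fun _ _ h => .of _ _ h) fun a ha => by
    simp only [totalLength_append, totalLength_cons]
    omega

lemma FLle_iff {w : Word A} {L : ℕ} : FLle R w L ↔ w.length ≤ L ∧ Conv R L w [] := by
  simpa [FLle] using BReach.exists_seq_iff (r := Move R) (size := List.length) (· = [])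

lemma FFLle_iff {w : Word A} {L : ℕ} : FFLle R w L ↔ w.length ≤ L ∧ ConvC R L w [] := by
  simpa [FFLle] using BReach.exists_seq_iff (r := MoveC R) (size := List.length) (· = [])

lemma FFFLle_iff {w : Word A} {L : ℕ} : FFFLle R w L ↔
    w.length ≤ L ∧ ∃ l : List (Word A), (∀ u ∈ l, u = []) ∧ ConvF R L [w] l := by
  simpa [FFFLle] using BReach.exists_seq_iff (x := [w]) (L := L) (r := MoveF R)
    (size := totalLength)
    (fun l : List (Word A) => ∀ u ∈ l, u = [])

lemma NullHomotopic.exists_FLle {w : Word A} (h : NullHomotopic R w) : ∃ L, FLle R w L := by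
  obtain ⟨L, hL⟩ := BReach.exists_of_reflTransGen (size := List.length)
    (reflTransGen_move_of_wval_eq_one (nullHomotopic_iff.1 h))
  exact ⟨max w.length L, FLle_iff.2 ⟨le_max_left _ _, hL.mono (le_max_right _ _)⟩⟩

lemma FLle.toFFLle {w : Word A} {L : ℕ} (h : FLle R w L) : FFLle R w L := by
  rw [FLle_iff] at h
  exact FFLle_iff.2 ⟨h.1, h.2.toConvC⟩

lemma FFLle.toFFFLle {w : Word A} {L : ℕ} (h : FFLle R w L) : FFFLle R w L := by
  rw [FFLle_iff] at h
  exact FFFLle_iff.2 ⟨h.1, [[]], by simp, h.2.toConvF [] [] (by simp)⟩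

lemma finite_word_length_le [Finite A] (N : ℕ) : {w : Word A | w.length ≤ N}.Finite :=
  List.finite_length_le _ N

/-- Over a finite alphabet, words of bounded length with equal values are convertible into each
other through words of uniformly bounded length. -/
lemma exists_uniform_conv [Finite A] (R : Set (Word A)) (N : ℕ) :
    ∃ E, ∀ u v : Word A, u.length ≤ N → v.length ≤ N → wval R u = wval R v → Conv R E u v := by
  have h : ∀ p : Word A × Word A, ∃ E, wval R p.1 = wval R p.2 → Conv R E p.1 p.2 := fun p => by
    by_cases hp : wval R p.1 = wval R p.2
    · obtain ⟨E, hE⟩ := BReach.exists_of_reflTransGen (size := List.length)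
        (reflTransGen_move_of_wval_eq hp)
      exact ⟨E, fun _ => hE⟩
    · exact ⟨0, fun h => absurd h hp⟩
  choose E hE using h
  obtain ⟨M, hM⟩ := (((finite_word_length_le N).prod (finite_word_length_le N)).image E).bddAbove
  exact ⟨M, fun u v hu hv huv => (hE (u, v) huv).mono (hM ⟨(u, v), ⟨hu, hv⟩, rfl⟩)⟩

end Conversions

/-! ### Transporting paths along a coarse Lipschitz map -/

section Paths

variable {A A' : Type*} {R' : Set (Word A')} {R : Set (Word A)}

/-- The image of the path labelled `w` from `g`, where the edge from `g` labelled `p` is sent to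
a path labelled `φ g p`. -/
def pathImage (R : Set (Word A)) (φ : PGroup R → A × Bool → Word A') :
    PGroup R → Word A → Word A'
  | _, [] => []
  | g, p :: w => φ g p ++ pathImage R φ (g * wval R [p]) w

variable {φ : PGroup R → A × Bool → Word A'} {F : PGroup R → PGroup R'} {D : ℕ}

lemma pathImage_append (g : PGroup R) (u v : Word A) :
    pathImage R φ g (u ++ v) = pathImage R φ g u ++ pathImage R φ (g * wval R u) v := by
  induction u generalizing g with
  | nil => simp [pathImage]
  | cons p u ih => simp [pathImage, ih, wval_cons p u, mul_assoc]

lemma length_pathImage_le (hφ : ∀ g p, (φ g p).length ≤ D) (g : PGroup R) (w : Word A) :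
    (pathImage R φ g w).length ≤ D * w.length := by
  induction w generalizing g with
  | nil => simp [pathImage]
  | cons p u ih =>
    have h1 := hφ g p
    have h2 := ih (g * wval R [p])
    simp only [pathImage, List.length_append, List.length_cons]
    linarith [mul_add D u.length 1]

lemma wval_pathImage (hφ : ∀ g p, wval R' (φ g p) = (F g)⁻¹ * F (g * wval R [p]))
    (g : PGroup R) (w : Word A) :
    wval R' (pathImage R φ g w) = (F g)⁻¹ * F (g * wval R w) := by
  induction w generalizing g with
  | nil => simp [pathImage]
  | cons p u ih => simp [pathImage, ih, hφ, wval_cons p u, mul_assoc]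

/-- Data for transporting fillings: a map `F` between presented groups, words of length at most
`D` representing the images of edges, a bound `N` for the size of local changes over the source,
and a constant `E` such that words of length at most `M` with equal values over the target are
convertible through words of length at most `E`. -/
structure Transport (R : Set (Word A)) (R' : Set (Word A')) (F : PGroup R → PGroup R')
    (φ : PGroup R → A × Bool → Word A') (D N M E : ℕ) : Prop where
  two_le : 2 ≤ N
  length_rel : ∀ z ∈ R, z.length ≤ N
  length_le : ∀ g p, (φ g p).length ≤ D
  wval_eq : ∀ g p, wval R' (φ g p) = (F g)⁻¹ * F (g * wval R [p])
  mul_le : D * N ≤ M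
  conv : ∀ u v : Word A', u.length ≤ M → v.length ≤ M → wval R' u = wval R' v → Conv R' E u v

namespace Transport

variable {N M E L : ℕ}

lemma conv_move (T : Transport R R' F φ D N M E) (g : PGroup R) {u v : Word A} (h : Move R u v) :
    Conv R' (D * u.length + E) (pathImage R φ g u) (pathImage R φ g v) := by
  obtain ⟨p, x, y, q, rfl, rfl, hx, hy, hxy⟩ := h.exists_local T.two_le T.length_rel
  have hlen : ∀ (h : PGroup R) (w : Word A), w.length ≤ N → (pathImage R φ h w).length ≤ M :=
    fun h w hw => (length_pathImage_le T.length_le h w).trans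
      ((Nat.mul_le_mul_left D hw).trans T.mul_le)
  have hE := T.conv (pathImage R φ (g * wval R p) x) (pathImage R φ (g * wval R p) y)
    (hlen _ _ hx) (hlen _ _ hy) (by simp only [wval_pathImage T.wval_eq, hxy])
  simp only [pathImage_append, wval_append, hxy]
  refine hE.context _ _ ?_
  have h1 := length_pathImage_le T.length_le g p
  have h2 := length_pathImage_le T.length_le (g * (wval R p * wval R y)) q
  simp only [List.length_append, mul_add]
  omega

lemma conv_pathImage (T : Transport R R' F φ D N M E) (g : PGroup R) {u v : Word A}
    (h : Conv R L u v) : Conv R' (D * L + E) (pathImage R φ g u) (pathImage R φ g v) := by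
  induction h with
  | refl => exact .refl _
  | tail _ h ih =>
    exact ih.trans ((T.conv_move g h.1).mono
      (Nat.add_le_add_right (Nat.mul_le_mul_left D h.2.1) E))

lemma convC_move (T : Transport R R' F φ D N M E) (g : PGroup R) {u v : Word A}
    (h : MoveC R u v) (hu : wval R u = 1) :
    ∃ g', ConvC R' (D * u.length + E) (pathImage R φ g u) (pathImage R φ g' v) := by
  cases h with
  | of h => exact ⟨g, (T.conv_move g h).toConvC⟩
  | cyc h =>
    obtain ⟨x, y, rfl, rfl⟩ := h
    refine ⟨g * wval R x, ?_⟩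
    rw [wval_append] at hu
    have h1 := length_pathImage_le T.length_le g x
    have h2 := length_pathImage_le T.length_le (g * wval R x) y
    simp only [pathImage_append, mul_assoc, hu, mul_one, List.length_append, mul_add]
    refine .single (.cyc ⟨_, _, rfl, rfl⟩) ?_ ?_ <;>
    · simp only [List.length_append]
      omega

lemma convC_pathImage_nil (T : Transport R R' F φ D N M E) {u : Word A} (h : ConvC R L u []) :
    wval R u = 1 ∧ ∀ g, ConvC R' (D * L + E) (pathImage R φ g u) [] := by
  induction h using Relation.ReflTransGen.head_induction_on with
  | refl => exact ⟨wval_nil, fun _ => .refl _⟩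
  | head h _ ih =>
    have hu := h.1.wval_eq_one_iff.2 ih.1
    refine ⟨hu, fun g => ?_⟩
    obtain ⟨g', hg'⟩ := T.convC_move g h.1 hu
    exact (hg'.mono (Nat.add_le_add_right (Nat.mul_le_mul_left D h.2.1) E)).trans (ih.2 g')

lemma totalLength_pathImage_le (T : Transport R R' F φ D N M E) (l : List (PGroup R × Word A)) :
    totalLength (l.map fun x => pathImage R φ x.1 x.2) ≤ D * totalLength (l.map Prod.snd) := by
  induction l with
  | nil => simp
  | cons x l ih =>
    have := length_pathImage_le T.length_le x.1 x.2
    simp only [List.map_cons, totalLength_cons, mul_add]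
    omega

/-- A move on sequences of null-homotopic words lifts to the images of these words as loops, for
suitable choices of base points. -/
lemma convF_move (T : Transport R R' F φ D N M E) (l : List (PGroup R × Word A))
    {m : List (Word A)} (h : MoveF R (l.map Prod.snd) m) (hm : ∀ u ∈ m, wval R u = 1) :
    (∀ u ∈ l.map Prod.snd, wval R u = 1) ∧ ∃ l' : List (PGroup R × Word A), l'.map Prod.snd = m ∧
      ConvF R' (D * totalLength (l.map Prod.snd) + E)
        (l.map fun x => pathImage R φ x.1 x.2) (l'.map fun x => pathImage R φ x.1 x.2) := by
  generalize hl : l.map Prod.snd = l₀ at h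
  cases h with
  | @of l₁ l₂ w w' h =>
    obtain ⟨k₁, k₂, rfl, rfl, hk⟩ := List.map_eq_append_iff.1 hl
    obtain ⟨⟨g, w⟩, k₂, rfl, rfl, rfl⟩ := List.map_eq_cons_iff.1 hk
    simp only [List.forall_mem_append, List.forall_mem_cons] at hm ⊢
    have hw := h.wval_eq_one_iff.2 hm.2.1
    refine ⟨⟨hm.1, hw, hm.2.2⟩, ?_⟩
    obtain ⟨g', hg'⟩ := T.convC_move g h hw
    refine ⟨k₁ ++ (g', w') :: k₂, by simp, ?_⟩
    simp only [List.map_append, List.map_cons]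
    refine hg'.toConvF _ _ ?_
    have h1 := T.totalLength_pathImage_le k₁
    have h2 := T.totalLength_pathImage_le k₂
    simp only [totalLength_append, totalLength_cons, mul_add]
    omega
  | frag l₁ l₂ u v =>
    obtain ⟨k₁, k₂, rfl, rfl, hk⟩ := List.map_eq_append_iff.1 hl
    obtain ⟨⟨g, w⟩, k₂, rfl, hw, rfl⟩ := List.map_eq_cons_iff.1 hk
    obtain rfl : w = u ++ v := hw
    simp only [List.forall_mem_append, List.forall_mem_cons] at hm ⊢
    refine ⟨⟨hm.1, by simp [hm.2.1, hm.2.2.1], hm.2.2.2⟩,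
      k₁ ++ (g, u) :: (g * wval R u, v) :: k₂, by simp, ?_⟩
    simp only [List.map_append, List.map_cons, pathImage_append]
    have h1 := T.totalLength_pathImage_le k₁
    have h2 := T.totalLength_pathImage_le k₂
    have h3 := length_pathImage_le T.length_le g u
    have h4 := length_pathImage_le T.length_le (g * wval R u) v
    refine .single (.frag _ _ _ _) ?_ ?_ <;>
    · simp only [totalLength_append, totalLength_cons, List.length_append, mul_add]
      omega

lemma convF_pathImage (T : Transport R R' F φ D N M E) {k m : List (Word A)}
    (h : ConvF R L k m) (hm : ∀ u ∈ m, u = []) :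
    (∀ u ∈ k, wval R u = 1) ∧ ∀ l : List (PGroup R × Word A), l.map Prod.snd = k →
      ∃ m' : List (Word A'), (∀ u ∈ m', u = []) ∧
        ConvF R' (D * L + E) (l.map fun x => pathImage R φ x.1 x.2) m' := by
  induction h using Relation.ReflTransGen.head_induction_on with
  | refl =>
    refine ⟨fun u hu => by rw [hm u hu, wval_nil], ?_⟩
    rintro l rfl
    refine ⟨_, ?_, .refl _⟩
    simp only [List.forall_mem_map] at hm ⊢
    intro x hx
    rw [hm x hx, pathImage]
  | @head a c h _ ih =>
    refine ⟨?_, ?_⟩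
    · have ha : (a.map fun w => ((1 : PGroup R), w)).map Prod.snd = a := by
        simp [Function.comp_def]
      have := (T.convF_move (a.map fun w => (1, w)) (by rw [ha]; exact h.1) ih.1).1
      rwa [ha] at this
    · rintro l rfl
      obtain ⟨-, l', hl', hc⟩ := T.convF_move l h.1 ih.1
      obtain ⟨m', hm', hc'⟩ := ih.2 l' hl'
      exact ⟨m', hm', (hc.mono (Nat.add_le_add_right (Nat.mul_le_mul_left D h.2.1) E)).trans hc'⟩

variable {ρ : PGroup R' → Word A'} {γ : PGroup R' → A' × Bool → Word A}
  {G : PGroup R' → PGroup R}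

/-- A word is convertible to its image under a round trip, conjugated by the paths `ρ` joining
points to their images under the round trip. -/
lemma conv_roundTrip (T : Transport R R' F φ D N M E) (hM : 2 * D + D * D + 1 ≤ M)
    (hγ : ∀ y p, (γ y p).length ≤ D)
    (hγval : ∀ y p, wval R (γ y p) = (G y)⁻¹ * G (y * wval R' [p]))
    (hρ : ∀ y, (ρ y).length ≤ D) (hρval : ∀ y, wval R' (ρ y) = y⁻¹ * F (G y))
    (y : PGroup R') (w : Word A') :
    Conv R' ((D * D + 1) * w.length + (E + D)) w (ρ y ++
      pathImage R φ (G y) (pathImage R' γ y w) ++ Word.inv (ρ (y * wval R' w))) := by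
  induction w generalizing y with
  | nil =>
    have h1 := hρ y
    refine (T.conv [] _ (by simp) ?_ (by simp [pathImage])).mono (by omega)
    simp only [pathImage, List.append_nil, wval_nil, mul_one, List.length_append,
      Word.length_inv]
    omega
  | cons p t ih =>
    have ht := ih (y * wval R' [p])
    have e1 : G y * wval R (γ y p) = G (y * wval R' [p]) := by simp [hγval]
    simp only [pathImage, pathImage_append, e1]
    rw [mul_assoc, ← wval_cons] at ht
    set X := pathImage R φ (G (y * wval R' [p])) (pathImage R' γ (y * wval R' [p]) t)
    set e := Word.inv (ρ (y * wval R' (p :: t)))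
    set Y := pathImage R φ (G y) (γ y p) with hY
    have hX : X.length ≤ D * D * t.length := by
      rw [mul_assoc]
      exact (length_pathImage_le T.length_le _ _).trans
        (Nat.mul_le_mul_left D (length_pathImage_le hγ _ _))
    have hYlen : Y.length ≤ D * D := (length_pathImage_le T.length_le _ _).trans
        (Nat.mul_le_mul_left D (hγ y p))
    have he : e.length ≤ D := by simpa [e] using hρ _
    have h1 := hρ y
    have h2 := hρ (y * wval R' [p])
    have step₁ := ht.context (L' := (D * D + 1) * (p :: t).length + (E + D)) [p] [] (by
      simp only [List.length_cons, List.length_nil, mul_add]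
      omega)
    have step₂ : Conv R' E ([p] ++ ρ (y * wval R' [p])) (ρ y ++ Y) := by
      refine T.conv _ _ ?_ ?_ ?_
      · simp only [List.length_append, List.length_cons, List.length_nil]
        omega
      · simp only [List.length_append]
        omega
      · rw [wval_append, wval_append, hY, wval_pathImage T.wval_eq, hρval, hρval, e1]
        group
    have step₃ := step₂.context (L' := (D * D + 1) * (p :: t).length + (E + D)) [] (X ++ e) (by
      simp only [List.length_cons, List.length_nil, List.length_append, mul_add, add_mul]
      omega)
    simp only [List.append_assoc, List.append_nil, List.nil_append] at step₁ step₃ ⊢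
    exact step₁.trans step₃

lemma FLle_of_pathImage (T : Transport R R' F φ D N M E) (hM : 2 * D + D * D + 1 ≤ M)
    (hγ : ∀ y p, (γ y p).length ≤ D)
    (hγval : ∀ y p, wval R (γ y p) = (G y)⁻¹ * G (y * wval R' [p]))
    (hρ : ∀ y, (ρ y).length ≤ D) (hρval : ∀ y, wval R' (ρ y) = y⁻¹ * F (G y))
    {w : Word A'} (hw : wval R' w = 1) (h : FLle R (pathImage R' γ 1 w) L)
    {B : ℕ} (hB : D * L + (D * D + 1) * w.length + (E + 2 * D) ≤ B) : FLle R' w B := by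
  have h0 := T.conv_roundTrip hM hγ hγval hρ hρval 1 w
  have h1 := hρ 1
  rw [hw, mul_one] at h0
  refine FLle_iff.2 ⟨by rw [add_mul] at hB; omega, (h0.mono (by omega)).trans ?_⟩
  have h2 := T.conv_pathImage (G 1) (FLle_iff.1 h).2
  refine (h2.context _ _ ?_).trans ((T.conv _ [] ?_ (by simp) ?_).mono (by omega))
  · rw [Word.length_inv]
    omega
  · simp only [pathImage, List.append_nil, List.length_append, Word.length_inv]
    omega
  · simp [pathImage]

/-- With cyclic conjugation available, the conjugating paths of a round trip can be removed. -/
lemma convC_roundTrip (T : Transport R R' F φ D N M E) (hM : 2 * D + D * D + 1 ≤ M)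
    (hγ : ∀ y p, (γ y p).length ≤ D)
    (hγval : ∀ y p, wval R (γ y p) = (G y)⁻¹ * G (y * wval R' [p]))
    (hρ : ∀ y, (ρ y).length ≤ D) (hρval : ∀ y, wval R' (ρ y) = y⁻¹ * F (G y))
    {w : Word A'} (hw : wval R' w = 1) :
    ConvC R' ((D * D + 1) * w.length + (E + 2 * D)) w
      (pathImage R φ (G 1) (pathImage R' γ 1 w)) := by
  have h0 := T.conv_roundTrip hM hγ hγval hρ hρval 1 w
  have h1 := hρ 1
  rw [hw, mul_one] at h0
  refine (h0.toConvC.mono (by omega)).trans ?_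
  have hX : (pathImage R φ (G 1) (pathImage R' γ 1 w)).length ≤ D * D * w.length := by
    rw [mul_assoc]
    exact (length_pathImage_le T.length_le _ _).trans
      (Nat.mul_le_mul_left D (length_pathImage_le hγ _ _))
  set X := pathImage R φ (G 1) (pathImage R' γ 1 w)
  have h2 : Conv R' E (Word.inv (ρ 1) ++ ρ 1) [] :=
    T.conv _ [] (by simp only [List.length_append, Word.length_inv]; omega) (by simp) (by simp)
  have h3 := h2.context (L' := (D * D + 1) * w.length + (E + 2 * D)) X []
    (by simp only [List.length_nil, add_mul]; omega)
  simp only [List.append_nil] at h3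
  refine .trans (.single (.cyc ⟨ρ 1, X ++ Word.inv (ρ 1), by simp, rfl⟩) ?_ ?_)
    (by simpa using h3.toConvC) <;>
  · simp only [List.length_append, Word.length_inv, add_mul]
    omega

lemma FFLle_of_pathImage (T : Transport R R' F φ D N M E) (hM : 2 * D + D * D + 1 ≤ M)
    (hγ : ∀ y p, (γ y p).length ≤ D)
    (hγval : ∀ y p, wval R (γ y p) = (G y)⁻¹ * G (y * wval R' [p]))
    (hρ : ∀ y, (ρ y).length ≤ D) (hρval : ∀ y, wval R' (ρ y) = y⁻¹ * F (G y))
    {w : Word A'} (hw : wval R' w = 1) (h : FFLle R (pathImage R' γ 1 w) L)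
    {B : ℕ} (hB : D * L + (D * D + 1) * w.length + (E + 2 * D) ≤ B) : FFLle R' w B := by
  have h0 := T.convC_roundTrip hM hγ hγval hρ hρval hw
  have h1 := (T.convC_pathImage_nil (FFLle_iff.1 h).2).2 (G 1)
  exact FFLle_iff.2 ⟨by rw [add_mul] at hB; omega, (h0.mono (by omega)).trans (h1.mono (by omega))⟩

lemma FFFLle_of_pathImage (T : Transport R R' F φ D N M E) (hM : 2 * D + D * D + 1 ≤ M)
    (hγ : ∀ y p, (γ y p).length ≤ D)
    (hγval : ∀ y p, wval R (γ y p) = (G y)⁻¹ * G (y * wval R' [p]))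
    (hρ : ∀ y, (ρ y).length ≤ D) (hρval : ∀ y, wval R' (ρ y) = y⁻¹ * F (G y))
    {w : Word A'} (hw : wval R' w = 1) (h : FFFLle R (pathImage R' γ 1 w) L)
    {B : ℕ} (hB : D * L + (D * D + 1) * w.length + (E + 2 * D) ≤ B) : FFFLle R' w B := by
  have h0 := (T.convC_roundTrip hM hγ hγval hρ hρval hw).toConvF [] [] le_rfl
  obtain ⟨-, m, hm, hc⟩ := FFFLle_iff.1 h
  obtain ⟨m', hm', hc'⟩ := (T.convF_pathImage hc hm).2 [(G 1, _)] rfl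
  refine FFFLle_iff.2 ⟨by rw [add_mul] at hB; omega, m', hm', ?_⟩
  exact (h0.mono (by simp only [totalLength_nil]; omega)).trans (hc'.mono (by omega))

end Transport

end Paths

/-! ### Filling functions -/

section FillingFunctions

variable {A A' : Type*} {R' : Set (Word A')} {R : Set (Word A)}

/-- Comparison of filling functions: the abstract form of the three filling lengths is
`P w L`, meaning that `w` can be filled through objects of size at most `L`. -/
lemma sSup_sInf_le [Finite A] {P : Word A → ℕ → Prop} {P' : Word A' → ℕ → Prop}
    (hP : ∀ w, NullHomotopic R w → ∃ L, P w L) (τ : Word A' → Word A) {a b : ℕ}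
    (hτ : ∀ w, NullHomotopic R' w → NullHomotopic R (τ w))
    (hlen : ∀ w, (τ w).length ≤ a * w.length)
    (hfill : ∀ w L, NullHomotopic R' w → P (τ w) L → P' w (a * L + b * w.length + b))
    {K : ℕ} (ha : a ≤ K) (hb : b ≤ K) (n : ℕ) :
    sSup ((fun w => sInf {L | P' w L}) '' {w | NullHomotopic R' w ∧ w.length ≤ n}) ≤
      K * sSup ((fun w => sInf {L | P w L}) '' {w | NullHomotopic R w ∧ w.length ≤ K * n + K}) +
        K * n + K := by
  refine csSup_le' ?_
  rintro _ ⟨w, ⟨hw, hwn⟩, rfl⟩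
  have hτw := hτ w hw
  have h1 : sInf {L | P (τ w) L} ≤ sSup ((fun w => sInf {L | P w L}) ''
      {w | NullHomotopic R w ∧ w.length ≤ K * n + K}) := by
    refine le_csSup (((finite_word_length_le (K * n + K)).subset fun u hu => hu.2).image
      _).bddAbove ⟨τ w, ⟨hτw, (hlen w).trans ?_⟩, rfl⟩
    exact (Nat.mul_le_mul ha hwn).trans (Nat.le_add_right _ _)
  have h2 : P (τ w) (sInf {L | P (τ w) L}) := Nat.sInf_mem (hP _ hτw)
  refine (Nat.sInf_le (hfill w _ hw h2)).trans ?_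
  gcongr

/-- One half of the comparison: a coarse Lipschitz map `F` with a coarse Lipschitz coarse right
inverse `G` bounds the filling functions of the target by those of the source. -/
lemma exists_forall_fillingLength_le [Finite A] [Finite A'] (hR : R.Finite)
    (F : PGroup R → PGroup R') (G : PGroup R' → PGroup R) (D : ℕ)
    (hF : ∀ x p, wdist R' (F x) (F (x * wval R [p])) ≤ D)
    (hG : ∀ y p, wdist R (G y) (G (y * wval R' [p])) ≤ D)
    (hFG : ∀ y, wdist R' y (F (G y)) ≤ D) :
    ∃ K₀ : ℕ, ∀ K ≥ K₀, ∀ n : ℕ,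
      FLfn R' n ≤ K * FLfn R (K * n + K) + K * n + K ∧
      FFLfn R' n ≤ K * FFLfn R (K * n + K) + K * n + K ∧
      FFFLfn R' n ≤ K * FFFLfn R (K * n + K) + K * n + K := by
  choose φ hφ hφval using fun (x : PGroup R) (p : A × Bool) =>
    exists_word_length_eq_wdist (F x) (F (x * wval R [p]))
  choose γ hγ hγval using fun (y : PGroup R') (p : A' × Bool) =>
    exists_word_length_eq_wdist (G y) (G (y * wval R' [p]))
  choose ρ hρ hρval using fun y : PGroup R' => exists_word_length_eq_wdist y (F (G y))
  replace hφ := fun x p => (hφ x p).trans_le (hF x p)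
  replace hγ := fun y p => (hγ y p).trans_le (hG y p)
  replace hρ := fun y => (hρ y).trans_le (hFG y)
  obtain ⟨N, hN⟩ := (hR.image List.length).bddAbove
  set M := max (D * max 2 N) (2 * D + D * D + 1)
  obtain ⟨E, hE⟩ := exists_uniform_conv R' M
  have T : Transport R R' F φ D (max 2 N) M E :=
    { two_le := le_max_left _ _
      length_rel := fun z hz => (hN ⟨z, hz, rfl⟩).trans (le_max_right _ _)
      length_le := hφ
      wval_eq := hφval
      mul_le := le_max_left _ _
      conv := hE }
  have hM : 2 * D + D * D + 1 ≤ M := le_max_right _ _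
  have hnull : ∀ w, NullHomotopic R' w → NullHomotopic R (pathImage R' γ 1 w) := fun w hw => by
    rw [nullHomotopic_iff] at hw ⊢
    rw [wval_pathImage hγval, hw, mul_one, inv_mul_cancel]
  have hbound : ∀ m L : ℕ, D * L + (D * D + 1) * m + (E + 2 * D) ≤
      D * L + (D * D + 1 + (E + 2 * D)) * m + (D * D + 1 + (E + 2 * D)) := fun m L => by
    rw [add_mul _ (E + 2 * D)]
    omega
  have hlen := length_pathImage_le hγ (1 : PGroup R')
  refine ⟨max D (D * D + 1 + (E + 2 * D)), fun K hK n => ?_⟩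
  have ha := (le_max_left _ _).trans hK
  have hb := (le_max_right _ _).trans hK
  refine ⟨?_, ?_, ?_⟩
  · exact sSup_sInf_le (fun w hw => hw.exists_FLle) _ hnull hlen (fun w L hw h =>
      T.FLle_of_pathImage hM hγ hγval hρ hρval (nullHomotopic_iff.1 hw) h (hbound _ _)) ha hb n
  · exact sSup_sInf_le (fun w hw => hw.exists_FLle.imp fun _ => FLle.toFFLle) _ hnull hlen
      (fun w L hw h => T.FFLle_of_pathImage hM hγ hγval hρ hρval (nullHomotopic_iff.1 hw) h
        (hbound _ _)) ha hb n
  · exact sSup_sInf_le (fun w hw => hw.exists_FLle.imp fun _ h => h.toFFLle.toFFFLle) _ hnull hlen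
      (fun w L hw h => T.FFFLle_of_pathImage hM hγ hγval hρ hρval (nullHomotopic_iff.1 hw) h
        (hbound _ _)) ha hb n

end FillingFunctions

theorem fillingLength_quasiIsometry_invariant {A A' : Type*} [Finite A] [Finite A']
    (R : Set (Word A)) (R' : Set (Word A')) (hR : R.Finite) (hR' : R'.Finite)
    (f : PGroup R → PGroup R') (lam C : ℝ) (hlam : 1 ≤ lam) (hC : 0 ≤ C)
    (hlb : ∀ x y : PGroup R, lam⁻¹ * (wdist R x y : ℝ) - C ≤ (wdist R' (f x) (f y) : ℝ))
    (hub : ∀ x y : PGroup R, (wdist R' (f x) (f y) : ℝ) ≤ lam * (wdist R x y : ℝ) + C)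
    (hdense : ∀ y : PGroup R', ∃ x : PGroup R, (wdist R' (f x) y : ℝ) ≤ C) :
    ∃ K : ℕ, 0 < K ∧ ∀ n : ℕ,
      FLfn R' n ≤ K * FLfn R (K * n + K) + K * n + K ∧
      FLfn R n ≤ K * FLfn R' (K * n + K) + K * n + K ∧
      FFLfn R' n ≤ K * FFLfn R (K * n + K) + K * n + K ∧
      FFLfn R n ≤ K * FFLfn R' (K * n + K) + K * n + K ∧
      FFFLfn R' n ≤ K * FFFLfn R (K * n + K) + K * n + K ∧
      FFFLfn R n ≤ K * FFFLfn R' (K * n + K) + K * n + K := by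
  choose g hg using hdense
  have hlam0 : 0 < lam := by linarith
  have hlb' : ∀ x y : PGroup R, (wdist R x y : ℝ) ≤ lam * (wdist R' (f x) (f y) + C) :=
    fun x y => by
      have h := mul_le_mul_of_nonneg_left (sub_le_iff_le_add.1 (hlb x y)) hlam0.le
      rwa [mul_inv_cancel_left₀ hlam0.ne'] at h
  obtain ⟨D, hD⟩ := exists_nat_ge (lam * (1 + 3 * C) + C)
  have hlamC : 0 ≤ lam * C := by positivity
  have hf : ∀ x p, wdist R' (f x) (f (x * wval R [p])) ≤ D := fun x p => by
    have h1 := hub x (x * wval R [p])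
    have h2 : (wdist R x (x * wval R [p]) : ℝ) ≤ 1 := by exact_mod_cast wdist_mul_letter x p
    have h3 := mul_le_mul_of_nonneg_left h2 hlam0.le
    have h4 : (wdist R' (f x) (f (x * wval R [p])) : ℝ) ≤ D := by linarith
    exact_mod_cast h4
  have hgstep : ∀ y p, wdist R (g y) (g (y * wval R' [p])) ≤ D := fun y p => by
    set z := y * wval R' [p] with hz
    have h1 : (wdist R' y z : ℝ) ≤ 1 := by exact_mod_cast wdist_mul_letter y p
    have h2 : (wdist R' (f (g y)) (f (g z)) : ℝ) ≤
        wdist R' (f (g y)) y + (wdist R' y z + wdist R' z (f (g z))) := by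
      exact_mod_cast (wdist_triangle _ y _).trans
        (Nat.add_le_add_left (wdist_triangle y z _) _)
    have h3 := hg z
    rw [wdist_symm] at h3
    have h4 := mul_le_mul_of_nonneg_left
      (show (wdist R' (f (g y)) (f (g z)) : ℝ) + C ≤ 1 + 3 * C by linarith [hg y]) hlam0.le
    have h5 : (wdist R (g y) (g z) : ℝ) ≤ D := by linarith [hlb' (g y) (g z)]
    exact_mod_cast h5
  have hfg : ∀ y, wdist R' y (f (g y)) ≤ D := fun y => by
    have h1 : (wdist R' y (f (g y)) : ℝ) ≤ D := by
      rw [wdist_symm]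
      linarith [hg y]
    exact_mod_cast h1
  have hgf : ∀ x, wdist R x (g (f x)) ≤ D := fun x => by
    have h1 := hg (f x)
    rw [wdist_symm] at h1
    have h2 := mul_le_mul_of_nonneg_left
      (show (wdist R' (f x) (f (g (f x))) : ℝ) + C ≤ 1 + 3 * C by linarith) hlam0.le
    have h3 : (wdist R x (g (f x)) : ℝ) ≤ D := by linarith [hlb' x (g (f x))]
    exact_mod_cast h3
  obtain ⟨K₁, hK₁⟩ := exists_forall_fillingLength_le hR f g D hf hgstep hfg
  obtain ⟨K₂, hK₂⟩ := exists_forall_fillingLength_le hR' g f D hgstep hf hgf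
  refine ⟨K₁ + K₂ + 1, by omega, fun n => ?_⟩
  obtain ⟨a₁, a₂, a₃⟩ := hK₁ (K₁ + K₂ + 1) (by omega) n
  obtain ⟨b₁, b₂, b₃⟩ := hK₂ (K₁ + K₂ + 1) (by omega) n
  exact ⟨a₁, b₁, a₂, b₂, a₃, b₃⟩
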